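/- arXiv:1801.00927 — 2 statements merged into one kernel-verified Lean document; each statement's English description precedes it below -/
import Mathlib

section
/- Let B ∈ ℂ with |B| = 1, let L be an integer with L ≠ −1, and let F(z) = (e^z − 1)^L (e^z − B). If all zeros of F'' lie on the imaginary axis iℝ = {ix : x ∈ ℝ}, then F is given by one of: (i) F(z) = e^{2z} − 1; (ii) F(z) = e^z − B; (iii) F(z) = 1/(e^z − 1). -/
open Complex Filter Topology MeasureTheory
open scoped Classical

noncomputable section

/-- `mtilde f` is the function `z ↦ conj (f (conj z))`, denoted `f̃` in the paper. -/
def mtilde (f : ℂ → ℂ) : ℂ → ℂ := fun z => (starRingEnd ℂ) (f ((starRingEnd ℂ) z))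

/-- Equality of meromorphic functions: near every point of `ℂ`, the two functions agree on a
punctured neighbourhood (so the set where they disagree is closed and discrete). -/
def MeroEq (h₁ h₂ : ℂ → ℂ) : Prop := ∀ z : ℂ, ∀ᶠ w in 𝓝[≠] z, h₁ w = h₂ w

/-- `f` is strictly non-real: `f̃` is not a constant multiple of `f`. -/
def StrictlyNonReal (f : ℂ → ℂ) : Prop := ¬ ∃ c : ℂ, MeroEq (mtilde f) (fun z => c * f z)

/-- A rational function, as a meromorphic function on `ℂ`. -/
def IsRatFn (h : ℂ → ℂ) : Prop :=
  ∃ p q : Polynomial ℂ, q ≠ 0 ∧ MeroEq h (fun z => p.eval z / q.eval z)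

/-- The order of vanishing (negative at a pole) of a function at a point, when the function is
meromorphic there; junk value `0` otherwise. -/
def meroOrder (h : ℂ → ℂ) (z : ℂ) : WithTop ℤ :=
  if hh : MeromorphicAt h z then meromorphicOrderAt h z else 0

/-- The positive part of the logarithm. -/
def logPlus (x : ℝ) : ℝ := max (Real.log x) 0

/-- The Nevanlinna proximity function `m(r, h)`. -/
def proximity (h : ℂ → ℂ) (r : ℝ) : ℝ :=
  (2 * Real.pi)⁻¹ * ∫ θ in (0:ℝ)..(2 * Real.pi),
    logPlus ‖h ((r : ℂ) * Complex.exp (θ * Complex.I))‖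

/-- The multiplicity of a pole of `h` at `z` (0 if not a pole). -/
def poleMult (h : ℂ → ℂ) (z : ℂ) : ℕ := (-((meroOrder h z).untopD 0)).toNat

/-- The number of poles, counted with multiplicity, in the closed disc of radius `t`. -/
def poleCount (h : ℂ → ℂ) (t : ℝ) : ℝ := ∑ᶠ z ∈ Metric.closedBall (0:ℂ) t, (poleMult h z : ℝ)

/-- The integrated counting function `N(r, h)` of the poles of `h` (with multiplicity). -/
def NCount (h : ℂ → ℂ) (r : ℝ) : ℝ := ∫ t in (1:ℝ)..r, poleCount h t / t

/-- The Nevanlinna characteristic `T(r, h) = m(r, h) + N(r, h)`. -/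
def TChar (h : ℂ → ℂ) (r : ℝ) : ℝ := proximity h r + NCount h r

/-- The number of points of `S` in the closed disc of radius `t`. -/
def distinctCount (S : Set ℂ) (t : ℝ) : ℝ := (S ∩ Metric.closedBall (0:ℂ) t).ncard

/-- The integrated counting function `N̄(r, h)` of the distinct poles of `h`. -/
def NbarPoles (h : ℂ → ℂ) (r : ℝ) : ℝ :=
  ∫ t in (1:ℝ)..r, distinctCount {z | meroOrder h z < 0} t / t

/-- The integrated counting function `N̄(r, 1/h)` of the distinct zeros of `h`. -/
def NbarZeros (h : ℂ → ℂ) (r : ℝ) : ℝ :=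
  ∫ t in (1:ℝ)..r, distinctCount {z | 0 < meroOrder h z} t / t

/-- `h` has finite (Nevanlinna) order: `T(r, h) ≤ r ^ C` for all large `r`. -/
def FiniteOrder (h : ℂ → ℂ) : Prop := ∃ C : ℝ, ∀ᶠ r in atTop, TChar h r ≤ r ^ C

/-- `h` has finite lower order: `T(r, h) ≤ r ^ C` for arbitrarily large `r`. -/
def FiniteLowerOrder (h : ℂ → ℂ) : Prop := ∃ C : ℝ, ∃ᶠ r in atTop, TChar h r ≤ r ^ C

/-- The Setup of Section 3 of the paper: `M ≥ 4` and `f` is a strictly non-real meromorphic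
function in the plane such that `f, f', …, f^(M+3)` all have finitely many non-real zeros. -/
def Setup (M : ℕ) (f : ℂ → ℂ) : Prop :=
  4 ≤ M ∧ (∀ z, MeromorphicAt f z) ∧ StrictlyNonReal f ∧
    ∀ m, m ≤ M + 3 → {z : ℂ | 0 < meroOrder (iteratedDeriv m f) z ∧ z.im ≠ 0}.Finite

/-- The function `F_m(z) = z - f^(m)(z) / f^(m+1)(z)`. -/
def Fm (f : ℂ → ℂ) (m : ℕ) : ℂ → ℂ :=
  fun z => z - iteratedDeriv m f z / iteratedDeriv (m + 1) f z

/-- `Km` is the meromorphic function with finitely many zeros and poles satisfying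
`F_m' = K_m G_m'`, where `G_m` is the analogue of `F_m` for `g = f̃`. -/
def IsKm (f : ℂ → ℂ) (m : ℕ) (Km : ℂ → ℂ) : Prop :=
  (∀ z, MeromorphicAt Km z) ∧ {z | 0 < meroOrder Km z}.Finite ∧
    {z | meroOrder Km z < 0}.Finite ∧
    MeroEq (deriv (Fm f m)) (fun z => Km z * deriv (Fm (mtilde f) m) z)

end

lemma aux_deriv1 (B : ℂ) (L : ℤ) (F : ℂ → ℂ)
    (hF : ∀ z, F z = (Complex.exp z - 1) ^ L * (Complex.exp z - B)) (z : ℂ)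
    (hz : Complex.exp z ≠ 1) :
    deriv F z = (Complex.exp z - 1) ^ (L - 1) *
      ((L + 1) * Complex.exp z ^ 2 - (L * B + 1) * Complex.exp z) := by
  have hF' : F = fun z => (Complex.exp z - 1) ^ L * (Complex.exp z - B) := funext hF
  have h0 : Complex.exp z - 1 ≠ 0 := sub_ne_zero.2 hz
  have h1 : HasDerivAt (fun z => Complex.exp z - 1) (Complex.exp z) z :=
    (Complex.hasDerivAt_exp z).sub_const 1
  have h2 : HasDerivAt (fun z => Complex.exp z - B) (Complex.exp z) z :=
    (Complex.hasDerivAt_exp z).sub_const B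
  have h3 : HasDerivAt (fun z => (Complex.exp z - 1) ^ L)
      ((L * (Complex.exp z - 1) ^ (L - 1)) * Complex.exp z) z :=
    HasDerivAt.comp (h₂ := fun x : ℂ => x ^ L) z (hasDerivAt_zpow L (Complex.exp z - 1) (Or.inl h0)) h1
  have e : (Complex.exp z - 1) ^ L = (Complex.exp z - 1) ^ (L - 1) * (Complex.exp z - 1) := by
    rw [← zpow_add_one₀ h0]; congr 1; ring
  rw [hF']
  refine ((h3.mul h2).deriv).trans ?_
  rw [e]; ring

lemma aux_deriv2 (B : ℂ) (L : ℤ) (F : ℂ → ℂ)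
    (hF : ∀ z, F z = (Complex.exp z - 1) ^ L * (Complex.exp z - B)) (z : ℂ)
    (hz : Complex.exp z ≠ 1) :
    deriv (deriv F) z = Complex.exp z * (Complex.exp z - 1) ^ (L - 2) *
      ((L + 1) ^ 2 * Complex.exp z ^ 2 - (L ^ 2 * B + 3 * L + 2) * Complex.exp z
        + (L * B + 1)) := by
  have hev : deriv F =ᶠ[𝓝 z] fun z => (Complex.exp z - 1) ^ (L - 1) *
      ((L + 1) * Complex.exp z ^ 2 - (L * B + 1) * Complex.exp z) := by
    have : ∀ᶠ y in 𝓝 z, Complex.exp y ≠ 1 :=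
      (Complex.continuous_exp.continuousAt (x := z)).eventually_ne hz
    filter_upwards [this] with y hy using aux_deriv1 B L F hF y hy
  rw [hev.deriv_eq]
  have h0 : Complex.exp z - 1 ≠ 0 := sub_ne_zero.2 hz
  have h1 : HasDerivAt (fun z => Complex.exp z - 1) (Complex.exp z) z :=
    (Complex.hasDerivAt_exp z).sub_const 1
  have h3 : HasDerivAt (fun z => (Complex.exp z - 1) ^ (L - 1))
      ((((L - 1 : ℤ) : ℂ) * (Complex.exp z - 1) ^ (L - 1 - 1)) * Complex.exp z) z :=
    HasDerivAt.comp (h₂ := fun x : ℂ => x ^ (L - 1)) z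
      (hasDerivAt_zpow (L - 1) (Complex.exp z - 1) (Or.inl h0)) h1
  have hE := Complex.hasDerivAt_exp z
  have h4 := ((hE.pow 2).const_mul ((L : ℂ) + 1)).sub (hE.const_mul ((L : ℂ) * B + 1))
  have e : (Complex.exp z - 1) ^ (L - 1) = (Complex.exp z - 1) ^ (L - 2) * (Complex.exp z - 1) := by
    rw [← zpow_add_one₀ h0]; congr 1; ring
  have e2 : L - 1 - 1 = L - 2 := by ring
  refine ((h3.mul h4).deriv).trans ?_
  simp only [Pi.sub_apply, Pi.pow_apply]
  rw [e2, e]; push_cast; ring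

lemma aux_roots (a b c : ℂ) (ha : a ≠ 0) : ∃ r s : ℂ, a * r ^ 2 - b * r + c = 0 ∧
    a * s ^ 2 - b * s + c = 0 ∧ a * (r * s) = c := by
  obtain ⟨d, hd⟩ := IsAlgClosed.exists_pow_nat_eq (b ^ 2 - 4 * a * c) (n := 2) (by norm_num)
  refine ⟨(b + d) / (2 * a), (b - d) / (2 * a), ?_, ?_, ?_⟩ <;> field_simp <;>
    first | linear_combination hd | linear_combination -hd

/-- Lemma 2.9 of the paper: if `|B| = 1`, `L` is an integer different from `-1`
and all zeros of the second derivative of `F(z) = (exp z - 1)^L (exp z - B)` lie on the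
imaginary axis, then `F` is `exp (2z) - 1`, `exp z - B` or `1/(exp z - 1)`. -/
theorem statement_7 (B : ℂ) (hB : ‖B‖ = 1) (L : ℤ) (hL : L ≠ -1)
    (F : ℂ → ℂ) (hF : ∀ z, F z = (Complex.exp z - 1) ^ L * (Complex.exp z - B))
    (hzeros : ∀ z : ℂ, Complex.exp z ≠ 1 → deriv (deriv F) z = 0 → z.re = 0) :
    (∀ z, F z = Complex.exp (2 * z) - 1) ∨ (∀ z, F z = Complex.exp z - B) ∨
      (∀ z, F z = 1 / (Complex.exp z - 1)) := by
  have hroot : ∀ w : ℂ, w ≠ 0 → ((L : ℂ) + 1) ^ 2 * w ^ 2 - (L ^ 2 * B + 3 * L + 2) * w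
      + (L * B + 1) = 0 → ‖w‖ = 1 := by
    intro w hw hq
    by_cases h1 : w = 1
    · simp [h1]
    have he : Complex.exp (Complex.log w) = w := Complex.exp_log hw
    have := hzeros (Complex.log w) (by rwa [he]) (by
      rw [aux_deriv2 B L F hF _ (by rwa [he]), he, hq, mul_zero])
    rw [← he, Complex.norm_exp, this, Real.exp_zero]
  have hL1 : (L : ℂ) + 1 ≠ 0 := by
    intro h; apply hL
    have : ((L + 1 : ℤ) : ℂ) = 0 := by push_cast; exact h
    have := Int.cast_eq_zero.1 this
    omega
  have hBn : B.re ^ 2 + B.im ^ 2 = 1 := by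
    have := Complex.sq_norm B
    rw [hB, Complex.normSq_apply] at this; nlinarith
  have hB1 : B.re = 1 → B = 1 := by
    intro h; apply Complex.ext <;> simp [h]; rw [h] at hBn; nlinarith
  have hBm : B.re = -1 → B = -1 := by
    intro h; apply Complex.ext <;> simp [h]; rw [h] at hBn; nlinarith
  by_cases hc : (L : ℂ) * B + 1 = 0
  · have hre : (L : ℝ) * B.re = -1 := by
      have := congrArg Complex.re hc; simp at this; linarith
    have him : (L : ℝ) * B.im = 0 := by
      have := congrArg Complex.im hc; simpa using this
    have hL2 : (L : ℝ) ^ 2 = 1 := by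
      linear_combination (-(L : ℝ) ^ 2) * hBn + ((L : ℝ) * B.re - 1) * hre + (L : ℝ) * B.im * him
    have hL2' : L ^ 2 = 1 := by exact_mod_cast hL2
    have hLL : L = 1 := by
      have h : (L - 1) * (L + 1) = 0 := by linear_combination hL2'
      rcases mul_eq_zero.1 h with h | h <;> omega
    left
    subst hLL
    have hBB : B = -1 := by push_cast at hc; linear_combination hc
    intro z
    rw [hF, hBB, two_mul, Complex.exp_add]; simp; ring
  obtain ⟨r, s, hr, hs, hrs⟩ := aux_roots (((L : ℂ) + 1) ^ 2) (L ^ 2 * B + 3 * L + 2) (L * B + 1)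
    (pow_ne_zero 2 hL1)
  have hr0 : r ≠ 0 := by rintro rfl; apply hc; linear_combination -hrs
  have hs0 : s ≠ 0 := by rintro rfl; apply hc; linear_combination -hrs
  have hnr := hroot r hr0 hr
  have hns := hroot s hs0 hs
  have hn : ((L : ℝ) + 1) ^ 4 = L ^ 2 + 2 * L * B.re + 1 := by
    have h1 : ‖((L : ℂ) + 1) ^ 2 * (r * s)‖ ^ 2 = ‖(L : ℂ) * B + 1‖ ^ 2 := by rw [hrs]
    rw [norm_mul, norm_mul, hnr, hns, norm_pow, mul_one, mul_one] at h1
    have h2 : ‖(L : ℂ) + 1‖ ^ 2 = ((L : ℝ) + 1) ^ 2 := by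
      rw [Complex.sq_norm, Complex.normSq_apply]; simp; ring
    rw [h2, Complex.sq_norm, Complex.normSq_apply] at h1
    simp at h1
    linear_combination h1 + (L : ℝ) ^ 2 * hBn
  have hre1 : B.re ≤ 1 := by nlinarith [sq_nonneg B.im]
  have hre2 : -1 ≤ B.re := by nlinarith [sq_nonneg B.im]
  have hLle : L ≤ 0 := by
    by_contra! h
    have h1 : (1 : ℝ) ≤ L := by exact_mod_cast h
    nlinarith [mul_nonneg (by linarith : (0:ℝ) ≤ L) (sub_nonneg.2 hre1),
      pow_pos (by linarith : (0:ℝ) < L) 3, pow_pos (by linarith : (0:ℝ) < L) 4]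
  have hLge : -3 ≤ L := by
    by_contra! h
    have h1 : (L : ℝ) ≤ -4 := by exact_mod_cast (by omega : L ≤ -4)
    have h2 : ((L : ℝ) + 1) ^ 4 ≤ ((L : ℝ) - 1) ^ 2 := by nlinarith
    have h3 : -((L : ℝ) - 1) < ((L : ℝ) + 1) ^ 2 := by nlinarith
    nlinarith
  have : L = 0 ∨ L = -2 ∨ L = -3 := by omega
  rcases this with rfl | rfl | rfl
  · right; left; intro z; rw [hF]; simp
  · right; right
    have : B = 1 := hB1 (by push_cast at hn; linarith)
    intro z
    rw [hF, this]
    by_cases h0 : Complex.exp z - 1 = 0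
    · simp [h0]
    · rw [show (-2 : ℤ) = -1 - 1 by norm_num, zpow_sub_one₀ h0, zpow_neg_one]; field_simp
  · exfalso
    have : B = -1 := hBm (by push_cast at hn; linarith)
    have h := hroot (-2 + (Real.sqrt 3 : ℝ)) (by
      intro h
      have := congrArg Complex.re h
      simp at this
      nlinarith [Real.sq_sqrt (show (0:ℝ) ≤ 3 by norm_num)]) (by
      have h3 : ((Real.sqrt 3 : ℝ) : ℂ) ^ 2 = 3 := by
        rw [← Complex.ofReal_pow, Real.sq_sqrt (by norm_num)]; norm_num
      rw [this]; push_cast; linear_combination 4 * h3)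
    rw [show (-2 + (Real.sqrt 3 : ℝ) : ℂ) = ((-2 + Real.sqrt 3 : ℝ) : ℂ) by push_cast; ring,
      Complex.norm_real, Real.norm_eq_abs] at h
    have h4 : (-2 + Real.sqrt 3) ^ 2 = 1 := by rw [← sq_abs, h]; norm_num
    nlinarith [Real.sq_sqrt (show (0:ℝ) ≤ 3 by norm_num)]
end

section
/- Let A ∈ ℂ. Then every solution z ∈ ℂ of the equation tan z = z − A is real if and only if A ∈ πℤ = {nπ : n ∈ ℤ}. -/
open Complex Filter Topology MeasureTheory
open scoped Classical

theorem aux_sinh_le (y b : ℝ) (hb : 0 ≤ b) (y₁ : ℝ) (h1 : b ≤ y₁) (hy : y₁ ≤ y)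
    (h : Real.sinh y₁ ≤ (y₁ - b) * Real.cosh y₁) :
    Real.sinh y ≤ (y - b) * Real.cosh y := by
  have hd : ∀ t : ℝ, HasDerivAt (fun t => (t - b) * Real.cosh t - Real.sinh t)
      ((t - b) * Real.sinh t) t := by
    intro t
    have := (((hasDerivAt_id t).sub_const b).mul (Real.hasDerivAt_cosh t)).sub
      (Real.hasDerivAt_sinh t)
    exact this.congr_deriv (by simp)
  have hm : MonotoneOn (fun t => (t - b) * Real.cosh t - Real.sinh t) (Set.Ici b) := by
    apply monotoneOn_of_deriv_nonneg (convex_Ici b)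
    · exact fun t _ => (hd t).continuousAt.continuousWithinAt
    · exact fun t _ => (hd t).differentiableAt.differentiableWithinAt
    · intro t ht
      rw [interior_Ici] at ht
      rw [(hd t).deriv]
      have ht' : b < t := ht
      exact mul_nonneg (by linarith) (Real.sinh_nonneg_iff.2 (by linarith))
  have := hm (show y₁ ∈ Set.Ici b from h1) (show y ∈ Set.Ici b from h1.trans hy) hy
  simp only at this
  linarith

theorem aux_sinh_lt {y : ℝ} (hy : 0 < y) : Real.sinh y < y * Real.cosh y := by
  have hd : ∀ t : ℝ, HasDerivAt (fun t => t * Real.cosh t - Real.sinh t)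
      (t * Real.sinh t) t := by
    intro t
    have := ((hasDerivAt_id t).mul (Real.hasDerivAt_cosh t)).sub
      (Real.hasDerivAt_sinh t)
    exact this.congr_deriv (by simp)
  have hm : StrictMonoOn (fun t => t * Real.cosh t - Real.sinh t) (Set.Ici 0) := by
    apply strictMonoOn_of_deriv_pos (convex_Ici 0)
    · exact fun t _ => (hd t).continuousAt.continuousWithinAt
    · intro t ht
      rw [interior_Ici] at ht
      rw [(hd t).deriv]
      have ht' : 0 < t := ht
      exact mul_pos (by linarith) (Real.sinh_pos_iff.2 (by linarith))
  have := hm (show (0:ℝ) ∈ Set.Ici 0 from le_refl (0:ℝ)) (show y ∈ Set.Ici (0:ℝ) from hy.le) hy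
  simp at this
  linarith

/-- The equation in real coordinates. -/
theorem aux_eq (x y a b : ℝ) (hN : 0 < Real.cos x ^ 2 + Real.sinh y ^ 2) :
    let z : ℂ := x + y * I
    (Complex.cos z ≠ 0) ∧ (Complex.tan z = z - (a + b * I) ↔
      (x - a) * (Real.cos x ^ 2 + Real.sinh y ^ 2) = Real.sin x * Real.cos x ∧
      (y - b) * (Real.cos x ^ 2 + Real.sinh y ^ 2) = Real.sinh y * Real.cosh y) := by
  intro z
  have hc : Complex.cos z = (Real.cos x * Real.cosh y : ℝ) - (Real.sin x * Real.sinh y : ℝ) * I := by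
    simp only [z, Complex.cos_add_mul_I]; push_cast; ring
  have hs : Complex.sin z = (Real.sin x * Real.cosh y : ℝ) + (Real.cos x * Real.sinh y : ℝ) * I := by
    simp only [z, Complex.sin_add_mul_I]; push_cast; ring
  have e1 := Real.sin_sq_add_cos_sq x
  have e2 := Real.cosh_sq y
  have hne : Complex.cos z ≠ 0 := by
    intro h0
    rw [hc] at h0
    have hr := congrArg Complex.re h0
    have hi := congrArg Complex.im h0
    simp [-Complex.ofReal_mul, -Complex.ofReal_cos, -Complex.ofReal_sin, -Complex.ofReal_cosh, -Complex.ofReal_sinh] at hr hi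
    have : Real.cos x ^ 2 + Real.sinh y ^ 2 = (Real.cos x * Real.cosh y)^2 + (Real.sin x * Real.sinh y)^2 := by
      rw [mul_pow, mul_pow, e2]; linear_combination (-Real.sinh y ^ 2) * e1
    have h1 : Real.cos x * Real.cosh y = 0 := by simpa using hr
    have h2 : Real.sin x * Real.sinh y = 0 := by simpa using hi
    rw [h1, h2] at this
    simp at this
    linarith
  refine ⟨hne, ?_⟩
  have key : Complex.tan z = z - (a + b * I) ↔
      (Real.sin x * Real.cosh y = (x - a) * (Real.cos x * Real.cosh y) + (y - b) * (Real.sin x * Real.sinh y)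
      ∧ Real.cos x * Real.sinh y = (y - b) * (Real.cos x * Real.cosh y) - (x - a) * (Real.sin x * Real.sinh y)) := by
    rw [Complex.tan, div_eq_iff hne, hs, hc, Complex.ext_iff]
    simp only [z, add_re, add_im, sub_re, sub_im, mul_re, mul_im, ofReal_re, ofReal_im, I_re, I_im]
    constructor
    · rintro ⟨h1, h2⟩
      constructor <;> linarith
    · rintro ⟨h1, h2⟩
      constructor <;> linarith
  rw [key]
  set s := Real.sin x
  set c := Real.cos x
  set S := Real.sinh y
  set C := Real.cosh y
  constructor
  · rintro ⟨h1, h2⟩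
    constructor
    · linear_combination (-c * C) * h1 + s * S * h2 + (x - a) * (-S^2) * e1 + (s * c - (x - a) * c ^ 2) * e2
    · linear_combination (-s * S) * h1 - c * C * h2 + (S * C - (y - b) * S^2) * e1 - (y - b) * c ^ 2 * e2
  · rintro ⟨h1, h2⟩
    constructor
    · apply mul_right_cancel₀ hN.ne'
      linear_combination (-c * C) * h1 - s * S * h2
    · apply mul_right_cancel₀ hN.ne'
      linear_combination (s * S) * h1 - c * C * h2 + c * S * e1 - c * S * e2

theorem aux_real (x y : ℝ) (h1 : x * (Real.cos x ^ 2 + Real.sinh y ^ 2) = Real.sin x * Real.cos x)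
    (h2 : y * (Real.cos x ^ 2 + Real.sinh y ^ 2) = Real.sinh y * Real.cosh y) : y = 0 := by
  by_contra hy
  wlog hpos : 0 < y generalizing y with H
  · apply H (-y)
    · simpa using h1
    · simp only [Real.sinh_neg, Real.cosh_neg]; linear_combination -h2
    · simpa using hy
    · have := lt_of_le_of_ne (not_lt.1 hpos) hy
      linarith
  have hS : y < Real.sinh y := Real.self_lt_sinh_iff.2 hpos
  have hC : 1 < Real.cosh y := Real.one_lt_cosh.2 hy
  rcases eq_or_ne x 0 with rfl | hx
  · have := aux_sinh_lt hpos
    have e2 := Real.cosh_sq y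
    simp at h2
    have : y * Real.cosh y = Real.sinh y := by
      apply mul_right_cancel₀ (show Real.cosh y ≠ 0 by linarith)
      linear_combination h2 + y * e2
    linarith
  · have hN : 1 < Real.cos x ^ 2 + Real.sinh y ^ 2 := by
      by_contra hcon
      push Not at hcon
      nlinarith
    have h3 : |x| * (Real.cos x ^ 2 + Real.sinh y ^ 2) ≤ |x| := by
      have : |x| * (Real.cos x ^ 2 + Real.sinh y ^ 2) = |Real.sin x * Real.cos x| := by
        rw [← h1, abs_mul, abs_of_pos (a := Real.cos x ^ 2 + Real.sinh y ^ 2) (by linarith)]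
      rw [this, abs_mul]
      have ha : |Real.sin x| ≤ |x| := Real.abs_sin_le_abs
      have hb : |Real.cos x| ≤ 1 := Real.abs_cos_le_one x
      have := abs_nonneg (Real.sin x)
      nlinarith
    have : 0 < |x| := abs_pos.2 hx
    nlinarith

/-- Auxiliary cosine value. -/
noncomputable def auxPhi (b y : ℝ) : ℝ := 2 * (Real.sinh y * Real.cosh y / (y - b) - Real.sinh y ^ 2) - 1

theorem aux_exist (a b y₁ : ℝ) (hb : 0 ≤ b) (hy : b < y₁)
    (h1 : Real.sinh y₁ ≤ (y₁ - b) * Real.cosh y₁)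
    (h2 : (y₁ - b) * Real.sinh y₁ ≤ Real.cosh y₁)
    (ha : Real.arccos (auxPhi b y₁) / 2 ≤ a) (ha2 : a ≤ Real.pi / 2) :
    ∃ z : ℂ, Complex.cos z ≠ 0 ∧ Complex.tan z = z - (a + b * I) ∧ z.im ≠ 0 := by
  have pos : ∀ y, b < y → 0 < y - b ∧ 0 < Real.sinh y ∧ 0 < Real.cosh y := fun y h =>
    ⟨by linarith, Real.sinh_pos_iff.2 (by linarith), Real.cosh_pos y⟩
  -- the right end point
  obtain ⟨y₂, hy2, h3⟩ : ∃ y₂, y₁ ≤ y₂ ∧ (y₂ - b) * Real.sinh y₂ = Real.cosh y₂ := by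
    have hc : ContinuousOn (fun y => (y - b) * Real.sinh y - Real.cosh y)
        (Set.Icc y₁ (y₁ + 2)) := by
      apply Continuous.continuousOn
      fun_prop
    have h0 : (0:ℝ) ∈ Set.Icc ((y₁ - b) * Real.sinh y₁ - Real.cosh y₁)
        ((y₁ + 2 - b) * Real.sinh (y₁ + 2) - Real.cosh (y₁ + 2)) := by
      refine ⟨by linarith, ?_⟩
      have hs : y₁ + 2 < Real.sinh (y₁ + 2) := Real.self_lt_sinh_iff.2 (by linarith)
      have he : Real.cosh (y₁ + 2) - Real.sinh (y₁ + 2) ≤ 1 := by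
        rw [Real.cosh_sub_sinh]
        exact Real.exp_le_one_iff.2 (by linarith)
      nlinarith
    obtain ⟨y, hy, hy'⟩ := intermediate_value_Icc (by linarith) hc h0
    exact ⟨y, hy.1, by simp only at hy'; linarith⟩
  set F : ℝ → ℝ := fun y => Real.arccos (auxPhi b y) / 2 -
    Real.sin (Real.arccos (auxPhi b y)) / 2 * ((y - b) / (Real.sinh y * Real.cosh y)) with hF
  have hphi : ContinuousOn (auxPhi b) (Set.Icc y₁ y₂) := by
    unfold auxPhi
    have : ∀ y ∈ Set.Icc y₁ y₂, y - b ≠ 0 := fun y h => by have := h.1; linarith [pos y (by linarith)]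
    have hq : ContinuousOn (fun y => Real.sinh y * Real.cosh y / (y - b)) (Set.Icc y₁ y₂) := by
      apply ContinuousOn.div _ _ this <;> fun_prop
    have hr : ContinuousOn (fun y => Real.sinh y ^ 2) (Set.Icc y₁ y₂) := by fun_prop
    exact ((hq.sub hr).const_mul 2).sub continuousOn_const
  have hFc : ContinuousOn F (Set.Icc y₁ y₂) := by
    have hn : ∀ y ∈ Set.Icc y₁ y₂, Real.sinh y * Real.cosh y ≠ 0 := fun y h => by
      have := h.1
      obtain ⟨_, p, q⟩ := pos y (by linarith)
      positivity
    have ht : ContinuousOn (fun y => Real.arccos (auxPhi b y)) (Set.Icc y₁ y₂) :=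
      Real.continuous_arccos.comp_continuousOn hphi
    apply ContinuousOn.sub (ht.div_const 2)
    apply ContinuousOn.mul ((Real.continuous_sin.comp_continuousOn ht).div_const 2)
    apply ContinuousOn.div _ _ hn <;> fun_prop
  have hin : a ∈ Set.Icc (F y₁) (F y₂) := by
    constructor
    · have hs : 0 ≤ Real.sin (Real.arccos (auxPhi b y₁)) :=
        Real.sin_nonneg_of_nonneg_of_le_pi (Real.arccos_nonneg _) (Real.arccos_le_pi _)
      obtain ⟨p, q, r⟩ := pos y₁ hy
      have : 0 ≤ Real.sin (Real.arccos (auxPhi b y₁)) / 2 *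
        ((y₁ - b) / (Real.sinh y₁ * Real.cosh y₁)) := by positivity
      simp only [hF]
      linarith
    · obtain ⟨p, q, r⟩ := pos y₂ (by linarith)
      have : auxPhi b y₂ = -1 := by
        unfold auxPhi
        rw [← h3]
        field_simp
        ring
      simp only [hF, this, Real.arccos_neg_one, Real.sin_pi]
      linarith
  obtain ⟨y, hyI, hyF⟩ := intermediate_value_Icc hy2 hFc hin
  have hby : b < y := by have := hyI.1; linarith
  obtain ⟨p, q, r⟩ := pos y hby
  obtain ⟨p', q', r'⟩ := pos y₂ (by linarith)
  have e2 := Real.cosh_sq y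
  have g1 := aux_sinh_le y b hb y₁ hy.le hyI.1 h1
  have g2 : (y - b) * Real.sinh y ≤ Real.cosh y := by
    have hs : 0 ≤ Real.sinh (y₂ - y) := Real.sinh_nonneg_iff.2 (by linarith [hyI.2])
    rw [Real.sinh_sub] at hs
    have : (y - b) * Real.sinh y * Real.sinh y₂ ≤ Real.cosh y * Real.sinh y₂ := by
      have hm : (y - b) * Real.sinh y₂ ≤ (y₂ - b) * Real.sinh y₂ :=
        mul_le_mul_of_nonneg_right (by linarith [hyI.2]) q'.le
      nlinarith
    exact le_of_mul_le_mul_right this q'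
  have u1 : auxPhi b y ≤ 1 := by
    have : Real.sinh y * Real.cosh y / (y - b) ≤ Real.cosh y ^ 2 := by
      rw [div_le_iff₀ p]; nlinarith
    unfold auxPhi; linarith
  have u2 : -1 ≤ auxPhi b y := by
    have : Real.sinh y ^ 2 ≤ Real.sinh y * Real.cosh y / (y - b) := by
      rw [le_div_iff₀ p]; nlinarith
    unfold auxPhi; linarith
  set x := Real.arccos (auxPhi b y) / 2 with hx
  have hxx : Real.arccos (auxPhi b y) = 2 * x := by rw [hx]; ring
  have hcos : Real.cos (2 * x) = auxPhi b y := by rw [← hxx, Real.cos_arccos u2 u1]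
  have hN : Real.cos x ^ 2 + Real.sinh y ^ 2 = Real.sinh y * Real.cosh y / (y - b) := by
    rw [Real.cos_two_mul] at hcos
    unfold auxPhi at hcos
    linarith
  have hNpos : 0 < Real.cos x ^ 2 + Real.sinh y ^ 2 := by rw [hN]; positivity
  obtain ⟨k1, k2⟩ := aux_eq x y a b hNpos
  refine ⟨x + y * I, k1, k2.2 ⟨?_, ?_⟩, ?_⟩
  · simp only [hF, hxx, Real.sin_two_mul] at hyF
    rw [hN, ← hyF]
    field_simp
    ring
  · rw [hN]; field_simp
  · simp; linarith

/-- There is a non-real solution. -/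
def AuxBad (A : ℂ) : Prop := ∃ z : ℂ, Complex.cos z ≠ 0 ∧ Complex.tan z = z - A ∧ z.im ≠ 0

theorem aux_bad_main (a b : ℝ) (hb : 0 ≤ b) (ha : 0 ≤ a) (ha2 : a ≤ Real.pi / 2)
    (hab : 0 < b ∨ 0 < a) : AuxBad (a + b * I) := by
  rcases hb.eq_or_lt with rfl | hb'
  · have ha' : 0 < a := by simpa using hab
    have hc1 : ContinuousAt (fun y : ℝ => Real.arccos (1 - 2 * Real.sinh y ^ 2) / 2) 0 := by
      have : Continuous (fun y : ℝ => 1 - 2 * Real.sinh y ^ 2) := by fun_prop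
      exact ((Real.continuous_arccos.comp this).div_const 2).continuousAt
    have hc2 : ContinuousAt (fun y : ℝ => y * Real.sinh y - Real.cosh y) 0 := by fun_prop
    have ev1 := hc1.eventually_lt (continuousAt_const (y := a)) (by simpa using ha')
    have ev2 := hc2.eventually_lt (continuousAt_const (y := (0:ℝ))) (by simp)
    have ev : ∀ᶠ y in 𝓝[>] (0:ℝ), 0 < y ∧ Real.arccos (1 - 2 * Real.sinh y ^ 2) / 2 < a ∧
        y * Real.sinh y - Real.cosh y < 0 := by
      filter_upwards [self_mem_nhdsWithin, nhdsWithin_le_nhds ev1, nhdsWithin_le_nhds ev2]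
        with y h1 h2 h3 using ⟨h1, h2, h3⟩
    obtain ⟨y, hy, h1, h2⟩ := ev.exists
    apply aux_exist a 0 y le_rfl hy
    · simpa using (aux_sinh_lt hy).le
    · simp; linarith
    · have : 1 - 2 * Real.sinh y ^ 2 ≤ auxPhi 0 y := by
        unfold auxPhi
        have hS : y < Real.sinh y := Real.self_lt_sinh_iff.2 hy
        have hC := Real.one_le_cosh y
        have : 1 ≤ Real.sinh y * Real.cosh y / (y - 0) := by
          rw [sub_zero, le_div_iff₀ hy]; nlinarith
        linarith
      have := Real.arccos_le_arccos this
      linarith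
    · exact ha2
  · have hc : ContinuousOn (fun y => (y - b) * Real.cosh y - Real.sinh y)
        (Set.Icc b (b + 1)) := by
      apply Continuous.continuousOn
      fun_prop
    have h0 : (0:ℝ) ∈ Set.Icc ((b - b) * Real.cosh b - Real.sinh b)
        ((b + 1 - b) * Real.cosh (b + 1) - Real.sinh (b + 1)) := by
      have := Real.sinh_pos_iff.2 hb'
      have := Real.sinh_lt_cosh (b + 1)
      constructor <;> nlinarith
    obtain ⟨y, hy, hy'⟩ := intermediate_value_Icc (by linarith) hc h0
    simp only at hy'
    have hS : 0 < Real.sinh y := Real.sinh_pos_iff.2 (by linarith [hy.1])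
    have hC := Real.cosh_pos y
    have hby : b < y := by
      rcases hy.1.eq_or_lt with h | h
      · rw [← h] at hy' hS
        simp at hy'
        linarith
      · exact h
    have hyb : 0 < y - b := by linarith
    have hlt := Real.sinh_lt_cosh y
    apply aux_exist a b y hb hby
    · linarith
    · have : y - b ≤ 1 := by linarith [hy.2]
      nlinarith
    · have : auxPhi b y = 1 := by
        have e2 := Real.cosh_sq y
        have : Real.sinh y * Real.cosh y / (y - b) = Real.cosh y ^ 2 := by
          rw [div_eq_iff hyb.ne']; linear_combination (-Real.cosh y) * hy'
        unfold auxPhi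
        rw [this, e2]; ring
      rw [this]; simpa using ha
    · exact ha2

theorem aux_cos_shift (z : ℂ) (n : ℤ) (h : Complex.cos z ≠ 0) :
    Complex.cos (z + n * Real.pi) ≠ 0 := by
  rw [Complex.cos_antiperiodic.add_int_mul_eq n]

  exact mul_ne_zero (Int.cast_ne_zero.2 (Units.ne_zero _)) h

theorem aux_tan_shift (z : ℂ) (n : ℤ) :
    Complex.tan (z + n * Real.pi) = Complex.tan z := by
  simpa using (Complex.tan_periodic.int_mul n) z

theorem aux_bad_shift {A : ℂ} (n : ℤ) (h : AuxBad (A + n * Real.pi)) : AuxBad A := by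
  obtain ⟨z, h1, h2, h3⟩ := h
  refine ⟨z + (-n : ℤ) * Real.pi, aux_cos_shift z _ h1, ?_, ?_⟩
  · rw [aux_tan_shift, h2]; push_cast; ring
  · simpa using h3

theorem aux_bad_neg {A : ℂ} (h : AuxBad (-A)) : AuxBad A := by
  obtain ⟨z, h1, h2, h3⟩ := h
  refine ⟨-z, by simpa using h1, ?_, by simpa using h3⟩
  rw [Complex.tan_neg, h2]; ring

theorem aux_bad_conj {A : ℂ} (h : AuxBad ((starRingEnd ℂ) A)) : AuxBad A := by
  obtain ⟨z, h1, h2, h3⟩ := h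
  refine ⟨(starRingEnd ℂ) z, ?_, ?_, by simpa using h3⟩
  · rw [Complex.cos_conj]; simpa using h1
  · rw [Complex.tan_conj, h2]; simp

theorem aux_bad_nonneg (a b : ℝ) (hb : 0 ≤ b)
    (h : ¬ ∃ n : ℤ, (a + b * I : ℂ) = (n : ℂ) * (Real.pi : ℂ)) : AuxBad (a + b * I) := by
  have hpi := Real.pi_pos
  set n := ⌊a / Real.pi⌋ with hn
  have l1 : (n : ℝ) * Real.pi ≤ a := by
    have := Int.floor_le (a / Real.pi)
    rwa [le_div_iff₀ hpi] at this
  have l2 : a < (n + 1 : ℝ) * Real.pi := by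
    have := Int.lt_floor_add_one (a / Real.pi)
    rwa [div_lt_iff₀ hpi] at this
  rcases le_or_gt (a - n * Real.pi) (Real.pi / 2) with hh | hh
  · apply aux_bad_shift (-n)
    have := aux_bad_main (a - n * Real.pi) b hb (by linarith) hh ?_
    · convert this using 1
      push_cast; ring
    · by_contra hcon
      push Not at hcon
      apply h
      refine ⟨n, ?_⟩
      have hb0 : b = 0 := by linarith
      have ha0 : a = n * Real.pi := by linarith
      rw [hb0, ha0]; push_cast; ring
  · apply aux_bad_neg
    apply aux_bad_conj
    apply aux_bad_shift (n + 1)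
    have := aux_bad_main ((n + 1) * Real.pi - a) b hb (by linarith) (by linarith) (by right; linarith)
    convert this using 1
    simp
    ring

theorem aux_bad (A : ℂ) (h : ¬ ∃ n : ℤ, A = (n : ℂ) * (Real.pi : ℂ)) : AuxBad A := by
  rcases le_total 0 A.im with hb | hb
  · rw [← Complex.re_add_im A] at h ⊢
    exact aux_bad_nonneg _ _ hb h
  · apply aux_bad_conj
    have e : (starRingEnd ℂ) A = (A.re : ℂ) + ((-A.im : ℝ) : ℂ) * I := by
      apply Complex.ext <;> simp
    rw [e]
    apply aux_bad_nonneg _ _ (by linarith)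
    rintro ⟨n, hn⟩
    apply h
    refine ⟨n, ?_⟩
    rw [← e] at hn
    have := congrArg (starRingEnd ℂ) hn
    simpa using this

/-- Lemma 2.10 of the paper: for a complex number `A`, all solutions of
`tan z = z - A` (taken where `tan` is finite, i.e. `cos z` is nonzero) are real if and only
if `A` is an integer multiple of `pi`. -/
theorem statement_8 (A : ℂ) :
    (∀ z : ℂ, Complex.cos z ≠ 0 → Complex.tan z = z - A → z.im = 0) ↔
      ∃ n : ℤ, A = (n : ℂ) * (Real.pi : ℂ) := by
  constructor
  · intro H
    by_contra hcon
    obtain ⟨z, h1, h2, h3⟩ := aux_bad A hcon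
    exact h3 (H z h1 h2)
  · rintro ⟨n, rfl⟩ z h1 h2
    by_contra him
    have h2' : Complex.tan (z + (-n : ℤ) * Real.pi) = z + (-n : ℤ) * Real.pi - ((0:ℝ) + (0:ℝ) * I) := by
      rw [aux_tan_shift, h2]; push_cast; ring
    set w := z + (-n : ℤ) * Real.pi with hw
    have hwim : w.im = z.im := by simp [hw]
    have hS : Real.sinh w.im ≠ 0 := by rw [hwim]; simpa using him
    rw [← Complex.re_add_im w] at h2'
    have hN : 0 < Real.cos w.re ^ 2 + Real.sinh w.im ^ 2 := by positivity
    obtain ⟨q1, q2⟩ := ((aux_eq w.re w.im 0 0 hN).2).1 h2'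
    apply him
    rw [← hwim]
    exact aux_real w.re w.im (by simpa using q1) (by simpa using q2)
end
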